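/- arXiv:1903.05494 — 2 statements merged into one kernel-verified Lean document; each statement's English description precedes it below -/
import Mathlib

section
/- Let C_1 ⊇ C_2 ⊇ ... ⊇ C_s be nested linear codes in F_q^n with minimum distances d_1, ..., d_s, and let A ∈ F_q^{s×l} be a matrix of rank s. For each i, let D_i denote the minimum distance of the linear code spanned by the first i rows of A. Then the minimum distance of the matrix-product code C = [C_1, ..., C_s]A equals min{D_1 d_1, D_2 d_2, ..., D_s d_s}. -/
open scoped Pointwise

/-- Hamming weight of a vector. -/
noncomputable def wt {ι F : Type*} [Fintype ι] [Zero F] (x : ι → F) : ℕ :=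
  letI := Classical.decEq F
  (Finset.univ.filter fun i => x i ≠ 0).card

/-- Minimum distance (= minimum weight) of a code given as a set. -/
noncomputable def minDist {ι F : Type*} [Fintype ι] [Zero F] (C : Set (ι → F)) : ℕ :=
  sInf (wt '' {x ∈ C | x ≠ 0})

/-- The matrix-product code `[C_1, …, C_s]A`, a subspace of `F^{l·n}`: the codeword
corresponding to `(c_1,…,c_s)` has `(j,k)` entry `∑ i, A i j * (c i) k`. -/
noncomputable def matrixProdCode {F : Type*} [Field F] {n s l : ℕ}
    (C : Fin s → Submodule F (Fin n → F)) (A : Matrix (Fin s) (Fin l) F) :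
    Submodule F (Fin l × Fin n → F) :=
  Submodule.map
    (show (Fin s → Fin n → F) →ₗ[F] (Fin l × Fin n → F) from
      { toFun := fun c (jk : Fin l × Fin n) => ∑ i, A i jk.1 * c i jk.2
        map_add' := by
          intro a b; funext jk
          simp [mul_add, Finset.sum_add_distrib]
        map_smul' := by
          intro r a; funext jk
          simp [Finset.mul_sum, mul_left_comm] })
    (Submodule.pi Set.univ C)

lemma wt_prod {ι κ F : Type*} [Fintype ι] [Fintype κ] [Zero F] (y : ι × κ → F) :
    wt y = ∑ k, wt fun j => y (j, k) := by
  classical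
  simp only [wt, Finset.card_filter]
  exact Fintype.sum_prod_type_right _

lemma mul_wt_le_wt {ι κ F : Type*} [Fintype ι] [Fintype κ] [Zero F]
    (y : ι × κ → F) (x : κ → F) (D : ℕ) (h : ∀ k, x k ≠ 0 → D ≤ wt fun j => y (j, k)) :
    D * wt x ≤ wt y := by
  classical
  rw [wt_prod]
  calc D * wt x = ∑ k with x k ≠ 0, D := by
        simp [wt, mul_comm]
    _ ≤ ∑ k with x k ≠ 0, wt fun j => y (j, k) :=
        Finset.sum_le_sum fun k hk => h k (by simpa using hk)
    _ ≤ ∑ k, wt fun j => y (j, k) :=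
        Finset.sum_le_sum_of_subset (Finset.subset_univ _)

lemma wt_mul {ι κ F : Type*} [Fintype ι] [Fintype κ] [MulZeroClass F] [NoZeroDivisors F]
    (v : ι → F) (x : κ → F) : wt (fun jk : ι × κ => v jk.1 * x jk.2) = wt v * wt x := by
  classical
  simp only [wt]
  rw [← Finset.card_product]
  congr 1
  ext ⟨j, k⟩
  simp

lemma minDist_le_wt {ι F : Type*} [Fintype ι] [Zero F] {C : Set (ι → F)} {x : ι → F}
    (hx : x ∈ C) (h0 : x ≠ 0) : minDist C ≤ wt x :=
  Nat.sInf_le ⟨x, ⟨hx, h0⟩, rfl⟩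

lemma exists_wt_eq_minDist {ι F : Type*} [Fintype ι] [Field F] {C : Submodule F (ι → F)}
    (hC : C ≠ ⊥) : ∃ x ∈ C, x ≠ 0 ∧ wt x = minDist (C : Set (ι → F)) := by
  obtain ⟨y, hy, hy0⟩ := Submodule.exists_mem_ne_zero_of_ne_bot hC
  obtain ⟨x, ⟨hx, hx0⟩, hxw⟩ := Nat.sInf_mem
    (s := wt '' {x ∈ (C : Set (ι → F)) | x ≠ 0}) ⟨_, y, ⟨hy, hy0⟩, rfl⟩
  exact ⟨x, hx, hx0, hxw⟩

lemma mem_matrixProdCode {F : Type*} [Field F] {n s l : ℕ}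
    {C : Fin s → Submodule F (Fin n → F)} {A : Matrix (Fin s) (Fin l) F}
    {y : Fin l × Fin n → F} :
    y ∈ matrixProdCode C A ↔
      ∃ c : Fin s → Fin n → F, (∀ i, c i ∈ C i) ∧ y = fun jk => ∑ i, A i jk.1 * c i jk.2 := by
  simp only [matrixProdCode, Submodule.mem_map, Submodule.mem_pi, Set.mem_univ, true_imp_iff]
  exact exists_congr fun c => and_congr_right fun _ => eq_comm

/-- The tensor product of a vector in the span of the first `i` rows with a codeword of `C i`
belongs to the matrix-product code. -/
lemma mul_mem_matrixProdCode {F : Type*} [Field F] {n s l : ℕ}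
    {C : Fin s → Submodule F (Fin n → F)} (hnested : ∀ i j : Fin s, i ≤ j → C j ≤ C i)
    {A : Matrix (Fin s) (Fin l) F} {i : Fin s} {v : Fin l → F}
    (hv : v ∈ Submodule.span F {v : Fin l → F | ∃ r : Fin s, (r : ℕ) ≤ (i : ℕ) ∧ v = A r})
    {x : Fin n → F} (hx : x ∈ C i) :
    (fun jk : Fin l × Fin n => v jk.1 * x jk.2) ∈ matrixProdCode C A := by
  induction hv using Submodule.span_induction with
  | mem v hv =>
    obtain ⟨r, hr, rfl⟩ := hv
    refine mem_matrixProdCode.2 ⟨Pi.single r x, fun t => ?_, ?_⟩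
    · by_cases h : t = r
      · subst h
        simpa using hnested t i hr hx
      · simp [h]
    · funext jk
      rw [Finset.sum_eq_single r] <;> simp +contextual
  | zero =>
    convert (matrixProdCode C A).zero_mem using 1
    funext jk
    simp
  | add u v _ _ hu hv =>
    convert (matrixProdCode C A).add_mem hu hv using 1
    funext jk
    simp [add_mul]
  | smul a v _ hv =>
    convert (matrixProdCode C A).smul_mem a hv using 1
    funext jk
    simp [mul_assoc]

/-- A nonzero codeword whose last nonzero component is `c i` has weight at least `D_i d_i`. -/
lemma exists_minDist_mul_minDist_le_wt {F : Type*} [Field F] {n s l : ℕ}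
    {C : Fin s → Submodule F (Fin n → F)} {A : Matrix (Fin s) (Fin l) F}
    (hA : LinearIndependent F A.row) {y : Fin l × Fin n → F} (hy : y ∈ matrixProdCode C A)
    (hy0 : y ≠ 0) :
    ∃ i : Fin s,
      minDist ((Submodule.span F {v : Fin l → F | ∃ r : Fin s, (r : ℕ) ≤ (i : ℕ) ∧ v = A r} :
          Submodule F (Fin l → F)) : Set (Fin l → F)) *
        minDist (C i : Set (Fin n → F)) ≤ wt y := by
  classical
  obtain ⟨c, hc, rfl⟩ := mem_matrixProdCode.1 hy
  have hne : (Finset.univ.filter fun i => c i ≠ 0).Nonempty := by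
    by_contra h
    refine hy0 (funext fun jk => Finset.sum_eq_zero fun i _ => ?_)
    have hi : c i = 0 := by
      by_contra hi
      exact h ⟨i, by simpa using hi⟩
    simp [hi]
  obtain ⟨i, hi, hmax⟩ := Finset.exists_max_image _ id hne
  simp only [Finset.mem_filter, Finset.mem_univ, true_and, id] at hi hmax
  refine ⟨i, (Nat.mul_le_mul_left _ (minDist_le_wt (hc i) hi)).trans
    (mul_wt_le_wt _ _ _ fun k hk => ?_)⟩
  have hcol : (fun j => ∑ r, A r j * c r k) = ∑ r, c r k • A.row r := by
    funext j
    simp [Finset.sum_apply, mul_comm]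
  refine minDist_le_wt ?_ ?_ <;> simp only [hcol]
  · refine Submodule.sum_mem _ fun r _ => ?_
    by_cases hr : c r = 0
    · simp [hr]
    · exact Submodule.smul_mem _ _ (Submodule.subset_span ⟨r, hmax r hr, rfl⟩)
  · exact fun h0 => hk (Fintype.linearIndependent_iff.1 hA _ h0 i)

lemma linearIndependent_row_of_rank_eq {F : Type*} [Field F] {s l : ℕ}
    {A : Matrix (Fin s) (Fin l) F} (hA : A.rank = s) : LinearIndependent F A.row := by
  rw [linearIndependent_iff_card_eq_finrank_span, Set.finrank, ← A.rank_eq_finrank_span_row, hA,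
    Fintype.card_fin]

/-- For nested constituent codes `C_1 ⊇ C_2 ⊇ ⋯ ⊇ C_s` the bound
`d(C) ≥ min_i D_i d_i` for the matrix-product code `C = [C_1,…,C_s]A` is attained with
equality, where `D_i` is the minimum distance of the code spanned by the first `i` rows
of the rank-`s` matrix `A`. -/
theorem matrixProdCode_minDist_eq_of_nested
    {F : Type*} [Field F] [Fintype F] {n s l : ℕ} (hs : 0 < s)
    (C : Fin s → Submodule F (Fin n → F))
    (hnested : ∀ i j : Fin s, i ≤ j → C j ≤ C i)
    (hC : ∀ i, C i ≠ ⊥)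
    (A : Matrix (Fin s) (Fin l) F) (hA : A.rank = s) :
    minDist (matrixProdCode C A : Set (Fin l × Fin n → F)) =
      ⨅ i : Fin s,
        minDist ((Submodule.span F {v : Fin l → F | ∃ r : Fin s, (r : ℕ) ≤ (i : ℕ) ∧ v = A r} :
            Submodule F (Fin l → F)) : Set (Fin l → F)) *
          minDist (C i : Set (Fin n → F)) := by
  have hrow := linearIndependent_row_of_rank_eq hA
  have : Nonempty (Fin s) := ⟨⟨0, hs⟩⟩
  have hspan (i : Fin s) : Submodule.span F
      {v : Fin l → F | ∃ r : Fin s, (r : ℕ) ≤ (i : ℕ) ∧ v = A r} ≠ ⊥ := fun h =>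
    hrow.ne_zero i (by
      rw [← Submodule.mem_bot F, ← h]
      exact Submodule.subset_span ⟨i, le_rfl, rfl⟩)
  have hprod (i : Fin s) : ∃ y ∈ matrixProdCode C A, y ≠ 0 ∧ wt y =
      minDist ((Submodule.span F {v : Fin l → F | ∃ r : Fin s, (r : ℕ) ≤ (i : ℕ) ∧ v = A r} :
          Submodule F (Fin l → F)) : Set (Fin l → F)) *
        minDist (C i : Set (Fin n → F)) := by
    obtain ⟨v, hv, hv0, hvw⟩ := exists_wt_eq_minDist (hspan i)
    obtain ⟨x, hx, hx0, hxw⟩ := exists_wt_eq_minDist (hC i)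
    refine ⟨_, mul_mem_matrixProdCode hnested hv hx, fun h => ?_, by rw [wt_mul, hvw, hxw]⟩
    obtain ⟨j, hj⟩ := Function.ne_iff.1 hv0
    obtain ⟨k, hk⟩ := Function.ne_iff.1 hx0
    exact mul_ne_zero hj hk (congrFun h (j, k))
  apply le_antisymm
  · refine le_ciInf fun i => ?_
    obtain ⟨y, hy, hy0, hyw⟩ := hprod i
    exact hyw ▸ minDist_le_wt hy hy0
  · obtain ⟨y, hy, hy0, -⟩ := hprod ⟨0, hs⟩
    have hbot : matrixProdCode C A ≠ ⊥ := fun h => hy0 ((Submodule.mem_bot F).1 (h ▸ hy))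
    obtain ⟨z, hz, hz0, hzw⟩ := exists_wt_eq_minDist hbot
    obtain ⟨i, hi⟩ := exists_minDist_mul_minDist_le_wt hrow hz hz0
    exact hzw ▸ (ciInf_le' _ i).trans hi
end

section
/- Let n be coprime to q, and let I_1 and I_2 be unions of q-cyclotomic cosets modulo n, with corresponding cyclic codes C(I_1) and C(I_2) of length n over F_q. Then the componentwise product C(I_1)*C(I_2) is a cyclic code of length n, dimension |I_1 + I_2|, and minimum distance at least n − Amp(I_1 + I_2) + 1, where I_1 + I_2 = {a + b mod n : a ∈ I_1, b ∈ I_2}. -/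
open scoped Pointwise

/-- Componentwise (Schur) product of two codes. -/
def schurProd {F : Type*} [Field F] {ι : Type*} (C C' : Submodule F (ι → F)) :
    Submodule F (ι → F) :=
  Submodule.span F {x | ∃ c ∈ C, ∃ c' ∈ C', x = c * c'}

/-- The cyclic code `C(I)` of length `n` over `F` with generating set `I` (where
`β` is a primitive `n`-th root of unity in the algebraic closure of `F`):
codewords are the coefficient vectors `c` whose polynomial `∑ c_k x^k` vanishes at
`β^j` for every `j` outside `I`; equivalently, the code generated by
`g = (x^n-1)/∏_{i∈I}(x-β^i)`. -/
noncomputable def cyclicCode (F : Type*) [Field F] (n : ℕ) [NeZero n]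
    (β : AlgebraicClosure F) (I : Set (ZMod n)) : Submodule F (Fin n → F) where
  carrier := {c | ∀ j : ZMod n, j ∉ I →
    ∑ k : Fin n, algebraMap F (AlgebraicClosure F) (c k) * β ^ (j * (k : ZMod n)).val = 0}
  zero_mem' := by intro j hj; simp
  add_mem' := by
    intro a b ha hb j hj
    simp only [Pi.add_apply, map_add, add_mul, Finset.sum_add_distrib, ha j hj, hb j hj,
      add_zero]
  smul_mem' := by
    intro r c hc j hj
    simp only [Pi.smul_apply, smul_eq_mul, map_mul, mul_assoc, ← Finset.mul_sum, hc j hj,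
      mul_zero]

/-- The amplitude of a subset of `ℤ/nℤ`: the least length of a cyclic interval
`{c, c+1, …, c+i-1}` containing it. -/
noncomputable def amp {n : ℕ} (I : Set (ZMod n)) : ℕ :=
  sInf {i : ℕ | ∃ c : ZMod n, I ⊆ {x | ∃ t : ℕ, t < i ∧ x = c + (t : ZMod n)}}

section ScalarExtension

variable {F K ι : Type*} [Field F] [Field K] [Algebra F K]

/-- The `K`-span of a code over the subfield `F`. -/
def extendScalars (K : Type*) [Field K] [Algebra F K] (S : Submodule F (ι → F)) :
    Submodule K (ι → K) :=
  Submodule.span K ((fun v k => algebraMap F K (v k)) '' (S : Set (ι → F)))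

theorem dual_comp_mem_of_mem_extendScalars {S : Submodule F (ι → F)} {x : ι → K}
    (hx : x ∈ extendScalars K S) (π : Module.Dual F K) : (fun k => π (x k)) ∈ S := by
  induction hx using Submodule.span_induction generalizing π with
  | mem x h =>
    obtain ⟨v, hv, rfl⟩ := h
    have : (fun k => π (algebraMap F K (v k))) = π 1 • v := by
      funext k
      rw [Algebra.algebraMap_eq_smul_one, map_smul, Pi.smul_apply, smul_eq_mul, smul_eq_mul,
        mul_comm]
    simpa only [this] using S.smul_mem _ hv
  | zero =>
    simp only [Pi.zero_apply, map_zero]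
    exact S.zero_mem
  | add x y _ _ hx hy => simpa using! S.add_mem (hx π) (hy π)
  | smul a x _ hx => simpa using! hx (π ∘ₗ LinearMap.mulLeft F a)

theorem mem_of_algebraMap_mem_extendScalars {S : Submodule F (ι → F)} {v : ι → F}
    (hv : (fun k => algebraMap F K (v k)) ∈ extendScalars K S) : v ∈ S := by
  obtain ⟨π, hπ⟩ : ∃ π : Module.Dual F K, π 1 ≠ 0 := by
    by_contra! h
    exact one_ne_zero ((Module.forall_dual_apply_eq_zero_iff F (1 : K)).1 h)
  have h := S.smul_mem (π 1)⁻¹ (dual_comp_mem_of_mem_extendScalars hv π)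
  convert h using 1
  funext k
  rw [Pi.smul_apply, Algebra.algebraMap_eq_smul_one, map_smul, smul_eq_mul, smul_eq_mul]
  field_simp

theorem LinearIndependent.algebraMap_comp {κ : Type*} {b : κ → ι → F}
    (hb : LinearIndependent F b) :
    LinearIndependent K fun s k => algebraMap F K (b s k) := by
  rw [linearIndependent_iff'] at hb ⊢
  intro t g hg s hs
  refine (Module.forall_dual_apply_eq_zero_iff F (g s)).1 fun π => ?_
  refine hb t (fun s => π (g s)) ?_ s hs
  funext k
  have := congrArg π (congrFun hg k)
  simpa [Finset.sum_apply, mul_comm (g _), ← Algebra.smul_def, mul_comm (π _)] using this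

theorem finrank_extendScalars [Finite ι] (S : Submodule F (ι → F)) :
    Module.finrank K (extendScalars K S) = Module.finrank F S := by
  have := Fintype.ofFinite ι
  let b := Module.finBasis F S
  have hb : LinearIndependent F fun s => (b s : ι → F) :=
    b.linearIndependent.map' S.subtype S.ker_subtype
  have hspan : extendScalars K S =
      Submodule.span K (Set.range fun s k => algebraMap F K ((b s : ι → F) k)) := by
    apply le_antisymm
    · refine Submodule.span_le.2 ?_
      rintro _ ⟨v, hv, rfl⟩
      have h : (fun k => algebraMap F K (v k)) =
          ∑ s, algebraMap F K (b.repr ⟨v, hv⟩ s) • fun k => algebraMap F K ((b s : ι → F) k) := by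
        have := congrArg Subtype.val (b.sum_repr ⟨v, hv⟩)
        funext k
        have hk : v k = ∑ s, b.repr ⟨v, hv⟩ s * (b s : ι → F) k := by
          refine (congrFun this k).symm.trans ?_
          simp [-Module.Basis.sum_repr, Finset.sum_apply]
        simp [hk, Finset.sum_apply, Algebra.smul_def]
      change (fun k => algebraMap F K (v k)) ∈ _
      rw [h]
      exact Submodule.sum_mem _ fun s _ =>
        Submodule.smul_mem _ _ (Submodule.subset_span ⟨s, rfl⟩)
    · refine Submodule.span_le.2 ?_
      rintro _ ⟨s, rfl⟩
      exact Submodule.subset_span ⟨_, (b s).2, rfl⟩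
  rw [hspan, finrank_span_eq_card hb.algebraMap_comp, Fintype.card_fin]

/-- Products of vectors in the extended codes lie in the extension of the Schur product. -/
theorem mul_mem_extendScalars_schurProd {C C' : Submodule F (ι → F)} {x y : ι → K}
    (hx : x ∈ extendScalars K C) (hy : y ∈ extendScalars K C') :
    x * y ∈ extendScalars K (schurProd C C') := by
  have h := Submodule.mul_mem_mul hx hy
  rw [extendScalars, extendScalars, Submodule.span_mul_span] at h
  refine Submodule.span_le.2 ?_ h
  rintro _ ⟨_, ⟨v, hv, rfl⟩, _, ⟨w, hw, rfl⟩, rfl⟩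
  exact Submodule.subset_span ⟨v * w, Submodule.subset_span ⟨v, hv, w, hw, rfl⟩, by
    funext k; simp⟩

end ScalarExtension

theorem mem_range_algebraMap_of_pow_card_eq {F K : Type*} [Field F] [Fintype F] [Field K]
    [Algebra F K] {x : K} (hx : x ^ Fintype.card F = x) : x ∈ Set.range (algebraMap F K) := by
  classical
  by_contra h
  have hp : (Polynomial.X ^ Fintype.card F - Polynomial.X : Polynomial K) ≠ 0 :=
    FiniteField.X_pow_card_sub_X_ne_zero K Fintype.one_lt_card
  have hsub : insert x (Finset.univ.image (algebraMap F K)) ⊆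
      (Polynomial.X ^ Fintype.card F - Polynomial.X : Polynomial K).roots.toFinset := by
    intro y hy
    rw [Multiset.mem_toFinset, Polynomial.mem_roots hp]
    rcases Finset.mem_insert.1 hy with rfl | hy
    · simp [hx]
    · obtain ⟨a, -, rfl⟩ := Finset.mem_image.1 hy
      simp [← map_pow, FiniteField.pow_card]
  have h1 := (Finset.card_le_card hsub).trans
    ((Multiset.toFinset_card_le _).trans (Polynomial.card_roots' _))
  rw [FiniteField.X_pow_card_sub_X_natDegree_eq K Fintype.one_lt_card,
    Finset.card_insert_of_notMem (by simpa using h),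
    Finset.card_image_of_injective _ (algebraMap F K).injective, Finset.card_univ] at h1
  omega

theorem natCast_ne_zero_of_coprime_card {F K : Type*} [Field F] [Fintype F] [Field K]
    [Algebra F K] {n : ℕ} (hcop : Nat.Coprime n (Fintype.card F)) : (n : K) ≠ 0 := by
  intro h
  have hq : ((Fintype.card F : ℕ) : K) = 0 := by
    rw [← map_natCast (algebraMap F K), FiniteField.cast_card_eq_zero, map_zero]
  have := (Nat.isCoprime_iff_coprime.2 hcop).map (Int.castRingHom K)
  simp [h, hq] at this

section Fourier

variable {K : Type*} [Field K] {n : ℕ}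

/-- The vector of values of an additive character at the multiples of `-i`. -/
def charVec (ψ : AddChar (ZMod n) K) (i : ZMod n) : Fin n → K :=
  fun k => ψ (-(i * ((k : ℕ) : ZMod n)))

theorem charVec_add (ψ : AddChar (ZMod n) K) (i j : ZMod n) :
    charVec ψ (i + j) = charVec ψ i * charVec ψ j := by
  funext k
  simp only [charVec, Pi.mul_apply, ← AddChar.map_add_eq_mul]
  congr 1
  ring

variable [NeZero n]

theorem bijective_finVal_zmod (n : ℕ) [NeZero n] :
    Function.Bijective fun k : Fin n => ((k : ℕ) : ZMod n) := by
  rw [Fintype.bijective_iff_injective_and_card]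
  refine ⟨fun a b h => ?_, by simp⟩
  have := (ZMod.natCast_eq_natCast_iff' _ _ _).1 h
  rw [Nat.mod_eq_of_lt a.2, Nat.mod_eq_of_lt b.2] at this
  exact Fin.ext this

theorem finVal_add_one_zmod (k : Fin n) :
    (((k + 1 : Fin n) : ℕ) : ZMod n) = ((k : ℕ) : ZMod n) + 1 := by
  rw [Fin.val_add, ZMod.natCast_mod, Nat.cast_add, Fin.val_one', ZMod.natCast_mod, Nat.cast_one]

/-- The discrete Fourier transform with respect to `ψ`. -/
def dft (ψ : AddChar (ZMod n) K) (x : Fin n → K) (j : ZMod n) : K :=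
  ∑ k : Fin n, x k * ψ (j * ((k : ℕ) : ZMod n))

theorem sum_addChar_mul_add_neg {ψ : AddChar (ZMod n) K} (hψ : ψ.IsPrimitive) (a b : ZMod n) :
    ∑ j, ψ (j * a + -(j * b)) = if a = b then (n : K) else 0 := by
  have h := AddChar.sum_mulShift (a - b) hψ
  rw [ZMod.card] at h
  simpa only [mul_sub, sub_eq_add_neg (_ * a), sub_eq_zero, Nat.cast_ite, Nat.cast_zero] using h

theorem sum_fin_addChar {ψ : AddChar (ZMod n) K} (hψ : ψ.IsPrimitive) (j : ZMod n) :
    ∑ k : Fin n, ψ (j * ((k : ℕ) : ZMod n)) = if j = 0 then (n : K) else 0 := by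
  have h := AddChar.sum_mulShift j hψ
  rw [ZMod.card] at h
  rw [(bijective_finVal_zmod n).sum_comp fun k => ψ (j * k)]
  simpa only [mul_comm j, Nat.cast_ite, Nat.cast_zero] using h

theorem dft_charVec {ψ : AddChar (ZMod n) K} (hψ : ψ.IsPrimitive) (i j : ZMod n) :
    dft ψ (charVec ψ i) j = if j = i then (n : K) else 0 := by
  rw [← if_congr (sub_eq_zero (a := j) (b := i)) rfl rfl, ← sum_fin_addChar hψ]
  refine Finset.sum_congr rfl fun k _ => ?_
  rw [charVec, ← AddChar.map_add_eq_mul]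
  congr 1
  ring

/-- Fourier inversion. -/
theorem sum_dft_smul_charVec {ψ : AddChar (ZMod n) K} (hψ : ψ.IsPrimitive) (x : Fin n → K) :
    ∑ j, dft ψ x j • charVec ψ j = (n : K) • x := by
  funext l
  simp only [Finset.sum_apply, Pi.smul_apply, smul_eq_mul, dft, charVec, Finset.sum_mul, mul_assoc,
    ← AddChar.map_add_eq_mul]
  rw [Finset.sum_comm]
  simp only [← Finset.mul_sum]
  simp [sum_addChar_mul_add_neg hψ, (bijective_finVal_zmod n).injective.eq_iff, mul_comm]

theorem mem_span_charVec_of_dft_eq_zero {ψ : AddChar (ZMod n) K} (hψ : ψ.IsPrimitive)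
    (hn : (n : K) ≠ 0) {I : Set (ZMod n)} {x : Fin n → K} (hx : ∀ j ∉ I, dft ψ x j = 0) :
    x ∈ Submodule.span K (charVec ψ '' I) := by
  have h : x = (n : K)⁻¹ • ∑ j, dft ψ x j • charVec ψ j := by
    rw [sum_dft_smul_charVec hψ, smul_smul, inv_mul_cancel₀ hn, one_smul]
  rw [h]
  refine Submodule.smul_mem _ _ (Submodule.sum_mem _ fun j _ => ?_)
  by_cases hj : j ∈ I
  · exact Submodule.smul_mem _ _ (Submodule.subset_span ⟨j, hj, rfl⟩)
  · simp [hx j hj]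

theorem dft_eq_zero_of_mem_span_charVec {ψ : AddChar (ZMod n) K} (hψ : ψ.IsPrimitive)
    {I : Set (ZMod n)} {x : Fin n → K} (hx : x ∈ Submodule.span K (charVec ψ '' I))
    {j : ZMod n} (hj : j ∉ I) : dft ψ x j = 0 := by
  induction hx using Submodule.span_induction with
  | mem x h =>
    obtain ⟨i, hi, rfl⟩ := h
    rw [dft_charVec hψ, if_neg (by rintro rfl; exact hj hi)]
  | zero => simp [dft]
  | add x y _ _ hx hy => simpa [dft, add_mul, Finset.sum_add_distrib] using! congrArg₂ (· + ·) hx hy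
  | smul a x _ hx => simpa [dft, mul_assoc, ← Finset.mul_sum] using! Or.inr hx

theorem linearIndependent_charVec {ψ : AddChar (ZMod n) K} (hψ : ψ.IsPrimitive)
    (hn : (n : K) ≠ 0) : LinearIndependent K (charVec ψ) := by
  rw [Fintype.linearIndependent_iff]
  intro g hg j
  have h : dft ψ (∑ i, g i • charVec ψ i) j = ∑ i, g i * dft ψ (charVec ψ i) j := by
    simp only [dft, Finset.sum_apply, Pi.smul_apply, smul_eq_mul, Finset.sum_mul, Finset.mul_sum,
      mul_assoc]
    exact Finset.sum_comm
  simp only [dft_charVec hψ] at h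
  rw [hg] at h
  simpa [dft, hn] using h

theorem finrank_span_charVec {ψ : AddChar (ZMod n) K} (hψ : ψ.IsPrimitive)
    (hn : (n : K) ≠ 0) (I : Set (ZMod n)) :
    Module.finrank K (Submodule.span K (charVec ψ '' I)) = I.ncard := by
  have := Fintype.ofFinite I
  have h := (linearIndependent_charVec hψ hn).comp ((↑) : I → ZMod n) Subtype.val_injective
  rw [Set.image_eq_range, ← Nat.card_coe_set_eq, Nat.card_eq_fintype_card]
  exact finrank_span_eq_card h

/-- The BCH bound, for vectors over the splitting field. -/
theorem le_card_support_of_mem_span_charVec {ψ : AddChar (ZMod n) K} (hψ : ψ.IsPrimitive)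
    {I : Set (ZMod n)} {c : ZMod n} {i : ℕ}
    (hI : I ⊆ {x | ∃ t : ℕ, t < i ∧ x = c + (t : ZMod n)}) {x : Fin n → K}
    (hx : x ∈ Submodule.span K (charVec ψ '' I)) (hx0 : x ≠ 0) :
    n + 1 ≤ wt x + i := by
  classical
  obtain ⟨P, hP, hxP⟩ : ∃ P ∈ Polynomial.degreeLT K i,
      ∀ k : Fin n, x k = charVec ψ c k * P.eval (charVec ψ 1 k) := by
    clear hx0
    induction hx using Submodule.span_induction with
    | mem x h =>
      obtain ⟨a, ha, rfl⟩ := h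
      obtain ⟨t, ht, rfl⟩ := hI ha
      refine ⟨Polynomial.X ^ t, ?_, fun k => ?_⟩
      · rw [Polynomial.mem_degreeLT, Polynomial.degree_X_pow]
        exact_mod_cast ht
      · rw [charVec_add, Pi.mul_apply, Polynomial.eval_pow, Polynomial.eval_X, charVec, charVec,
          charVec, ← AddChar.map_nsmul_eq_pow]
        congr 2
        simp
    | zero => exact ⟨0, Submodule.zero_mem _, by simp⟩
    | add x y _ _ hx hy =>
      obtain ⟨P, hP, hx⟩ := hx
      obtain ⟨Q, hQ, hy⟩ := hy
      exact ⟨P + Q, Submodule.add_mem _ hP hQ, fun k => by simp [hx, hy, mul_add]⟩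
    | smul a x _ hx =>
      obtain ⟨P, hP, hx⟩ := hx
      exact ⟨a • P, Submodule.smul_mem _ _ hP, fun k => by simp [hx, mul_left_comm]⟩
  have hP0 : P ≠ 0 := by
    rintro rfl
    exact hx0 (funext fun k => by simp [hxP])
  have hinj : Function.Injective (charVec ψ 1) := by
    intro k l hkl
    have hone : ψ (((k : ℕ) : ZMod n) - ((l : ℕ) : ZMod n)) = 1 := by
      have : ψ (((k : ℕ) : ZMod n) - ((l : ℕ) : ZMod n)) * charVec ψ 1 k = charVec ψ 1 l := by
        rw [charVec, charVec, ← AddChar.map_add_eq_mul]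
        congr 1
        ring
      rw [← hkl] at this
      exact mul_right_cancel₀ (AddChar.val_isUnit ψ _).ne_zero (this.trans (one_mul _).symm)
    have := (AddChar.IsPrimitive.zmod_char_eq_one_iff n hψ _).1 hone
    exact (bijective_finVal_zmod n).injective (sub_eq_zero.1 this)
  have hzeros : (Finset.univ.filter fun k => ¬ x k ≠ 0).card < i := by
    have hsub : (Finset.univ.filter fun k => ¬ x k ≠ 0).image (charVec ψ 1) ⊆
        P.roots.toFinset := by
      intro y hy
      obtain ⟨k, hk, rfl⟩ := Finset.mem_image.1 hy
      rw [Multiset.mem_toFinset, Polynomial.mem_roots hP0]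
      have hk0 : x k = 0 := by simpa using hk
      rw [hxP] at hk0
      exact (mul_eq_zero.1 hk0).resolve_left (AddChar.val_isUnit ψ _).ne_zero
    have := (Finset.card_le_card hsub).trans
      ((Multiset.toFinset_card_le _).trans (Polynomial.card_roots' _))
    rw [Finset.card_image_of_injective _ hinj] at this
    rw [Polynomial.mem_degreeLT, ← Polynomial.natDegree_lt_iff_degree_lt hP0] at hP
    exact this.trans_lt hP
  have hsum := Finset.card_filter_add_card_filter_not (s := Finset.univ) fun k => x k ≠ 0
  rw [Finset.card_univ, Fintype.card_fin] at hsum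
  have hwt : wt x = (Finset.univ.filter fun k => x k ≠ 0).card := by
    unfold wt
    congr
  omega

end Fourier

theorem wt_algebraMap {F K ι : Type*} [Field F] [Field K] [Algebra F K] [Fintype ι] (v : ι → F) :
    wt (fun k => algebraMap F K (v k)) = wt v := by
  classical
  unfold wt
  simp

theorem exists_subset_interval_amp {n : ℕ} [NeZero n] (I : Set (ZMod n)) :
    amp I ≤ n ∧ ∃ c : ZMod n, I ⊆ {x | ∃ t : ℕ, t < amp I ∧ x = c + (t : ZMod n)} := by
  have hn : n ∈ {i : ℕ | ∃ c : ZMod n, I ⊆ {x | ∃ t : ℕ, t < i ∧ x = c + (t : ZMod n)}} :=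
    ⟨0, fun x _ => ⟨x.val, ZMod.val_lt x, by simp⟩⟩
  exact ⟨Nat.sInf_le hn, Nat.sInf_mem ⟨n, hn⟩⟩

section CyclicCode

variable {F : Type*} [Field F] {n : ℕ} [NeZero n] {β : AlgebraicClosure F}

theorem mem_cyclicCode_iff_dft (hβ : β ^ n = 1) (I : Set (ZMod n)) (c : Fin n → F) :
    c ∈ cyclicCode F n β I ↔ ∀ j ∉ I,
      dft (AddChar.zmodChar n hβ) (fun k => algebraMap F (AlgebraicClosure F) (c k)) j = 0 :=
  Iff.rfl

theorem extendScalars_cyclicCode_le (hβ : IsPrimitiveRoot β n) (hn : (n : AlgebraicClosure F) ≠ 0)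
    (I : Set (ZMod n)) :
    extendScalars (AlgebraicClosure F) (cyclicCode F n β I) ≤
      Submodule.span (AlgebraicClosure F) (charVec (AddChar.zmodChar n hβ.pow_eq_one) '' I) := by
  refine Submodule.span_le.2 ?_
  rintro _ ⟨v, hv, rfl⟩
  exact mem_span_charVec_of_dft_eq_zero (AddChar.zmodChar_primitive_of_primitive_root n hβ) hn hv

theorem comp_add_one_mem_cyclicCode (hβ : β ^ n = 1) {I : Set (ZMod n)} {c : Fin n → F}
    (hc : c ∈ cyclicCode F n β I) : (fun k : Fin n => c (k + 1)) ∈ cyclicCode F n β I := by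
  rw [mem_cyclicCode_iff_dft hβ] at hc ⊢
  intro j hj
  have h : dft (AddChar.zmodChar n hβ) (fun k => algebraMap F (AlgebraicClosure F) (c k)) j =
      AddChar.zmodChar n hβ j *
        dft (AddChar.zmodChar n hβ) (fun k => algebraMap F (AlgebraicClosure F) (c (k + 1))) j := by
    rw [dft, dft, Finset.mul_sum, ← Equiv.sum_comp (Equiv.addRight (1 : Fin n))]
    refine Finset.sum_congr rfl fun k _ => ?_
    rw [Equiv.coe_addRight, finVal_add_one_zmod, mul_add, mul_one, AddChar.map_add_eq_mul]
    ring
  rw [hc j hj] at h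
  exact (mul_eq_zero.1 h.symm).resolve_left (AddChar.val_isUnit _ _).ne_zero

variable [Fintype F]

theorem charVec_mem_extendScalars_cyclicCode (hcop : Nat.Coprime n (Fintype.card F))
    (hβ : IsPrimitiveRoot β n) (hn : (n : AlgebraicClosure F) ≠ 0) {I : Set (ZMod n)}
    (hI : ∀ a ∈ I, (Fintype.card F : ZMod n) * a ∈ I) {i : ZMod n} (hi : i ∈ I) :
    charVec (AddChar.zmodChar n hβ.pow_eq_one) i ∈
      extendScalars (AlgebraicClosure F) (cyclicCode F n β I) := by
  classical
  set ψ := AddChar.zmodChar n hβ.pow_eq_one with hψdef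
  have hψ : ψ.IsPrimitive := AddChar.zmodChar_primitive_of_primitive_root n hβ
  let J : Finset (ZMod n) := Finset.univ.filter (· ∈ I)
  let e : ZMod n → Fin n → AlgebraicClosure F := fun l =>
    ∑ a ∈ J, ψ (-(a * l)) • charVec ψ a
  have hunit : IsUnit (Fintype.card F : ZMod n) := (ZMod.isUnit_iff_coprime _ _).2 hcop.symm
  have hJ : J.image ((Fintype.card F : ZMod n) * ·) = J := by
    refine Finset.eq_of_subset_of_card_le (fun a ha => ?_) ?_
    · obtain ⟨b, hb, rfl⟩ := Finset.mem_image.1 ha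
      simpa [J] using hI b (by simpa [J] using hb)
    · rw [Finset.card_image_of_injective _ hunit.mul_right_injective]
  have hfrob (l : ZMod n) (k : Fin n) : e l k ^ Fintype.card F = e l k := by
    have hterm : e l k = ∑ a ∈ J, ψ (-(a * (l + ((k : ℕ) : ZMod n)))) := by
      simp only [e, Finset.sum_apply, Pi.smul_apply, smul_eq_mul, charVec,
        ← AddChar.map_add_eq_mul]
      refine Finset.sum_congr rfl fun a _ => ?_
      congr 1
      ring
    rw [hterm]
    have h := map_sum (FiniteField.frobeniusAlgHom F (AlgebraicClosure F))
      (fun a => ψ (-(a * (l + ((k : ℕ) : ZMod n))))) J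
    simp only [FiniteField.coe_frobeniusAlgHom] at h
    rw [h]
    conv_rhs => rw [← hJ]
    rw [Finset.sum_image fun a _ b _ hab => hunit.mul_right_injective hab]
    refine Finset.sum_congr rfl fun a _ => ?_
    rw [← AddChar.map_nsmul_eq_pow]
    congr 1
    rw [nsmul_eq_mul]
    ring
  have he (l : ZMod n) : e l ∈ extendScalars (AlgebraicClosure F) (cyclicCode F n β I) := by
    choose v hv using fun k => mem_range_algebraMap_of_pow_card_eq (hfrob l k)
    refine Submodule.subset_span ⟨v, ?_, funext hv⟩
    refine (mem_cyclicCode_iff_dft hβ.pow_eq_one I v).2 fun j hj => ?_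
    rw [funext hv]
    refine dft_eq_zero_of_mem_span_charVec hψ (Submodule.sum_mem _ fun a ha => ?_) hj
    exact Submodule.smul_mem _ _ (Submodule.subset_span ⟨a, by simpa [J] using ha, rfl⟩)
  have hsum : ∑ l, ψ (i * l) • e l = (n : AlgebraicClosure F) • charVec ψ i := by
    simp only [e, Finset.smul_sum, smul_smul, ← AddChar.map_add_eq_mul]
    rw [Finset.sum_comm]
    simp only [← Finset.sum_smul]
    have h (a : ZMod n) : ∑ l, ψ (i * l + -(a * l)) =
        if i = a then (n : AlgebraicClosure F) else 0 := by
      simpa only [mul_comm] using sum_addChar_mul_add_neg hψ i a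
    simp [h, J, hi, ite_smul]
  rw [← one_smul (AlgebraicClosure F) (charVec ψ i), ← inv_mul_cancel₀ hn, ← smul_smul, ← hsum]
  exact Submodule.smul_mem _ _ (Submodule.sum_mem _ fun l _ => Submodule.smul_mem _ _ (he l))

theorem extendScalars_cyclicCode (hcop : Nat.Coprime n (Fintype.card F))
    (hβ : IsPrimitiveRoot β n) (hn : (n : AlgebraicClosure F) ≠ 0) {I : Set (ZMod n)}
    (hI : ∀ a ∈ I, (Fintype.card F : ZMod n) * a ∈ I) :
    extendScalars (AlgebraicClosure F) (cyclicCode F n β I) =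
      Submodule.span (AlgebraicClosure F) (charVec (AddChar.zmodChar n hβ.pow_eq_one) '' I) := by
  refine le_antisymm (extendScalars_cyclicCode_le hβ hn I) (Submodule.span_le.2 ?_)
  rintro _ ⟨i, hi, rfl⟩
  exact charVec_mem_extendScalars_cyclicCode hcop hβ hn hI hi

theorem schurProd_cyclicCode (hcop : Nat.Coprime n (Fintype.card F))
    (hβ : IsPrimitiveRoot β n) (hn : (n : AlgebraicClosure F) ≠ 0) {I₁ I₂ : Set (ZMod n)}
    (hI₁ : ∀ a ∈ I₁, (Fintype.card F : ZMod n) * a ∈ I₁)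
    (hI₂ : ∀ a ∈ I₂, (Fintype.card F : ZMod n) * a ∈ I₂) :
    schurProd (cyclicCode F n β I₁) (cyclicCode F n β I₂) = cyclicCode F n β (I₁ + I₂) := by
  have hψ := AddChar.zmodChar_primitive_of_primitive_root n hβ
  apply le_antisymm
  · refine Submodule.span_le.2 ?_
    rintro _ ⟨c, hc, c', hc', rfl⟩
    refine (mem_cyclicCode_iff_dft hβ.pow_eq_one _ _).2 fun j hj => ?_
    refine dft_eq_zero_of_mem_span_charVec hψ ?_ hj
    have h := Submodule.mul_mem_mul (mem_span_charVec_of_dft_eq_zero hψ hn hc)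
      (mem_span_charVec_of_dft_eq_zero hψ hn hc')
    rw [Submodule.span_mul_span] at h
    have hmul : (fun k => algebraMap F (AlgebraicClosure F) ((c * c') k)) =
        (fun k => algebraMap F (AlgebraicClosure F) (c k)) *
          fun k => algebraMap F (AlgebraicClosure F) (c' k) := by
      funext k; simp
    rw [hmul]
    refine Submodule.span_mono ?_ h
    rintro _ ⟨_, ⟨a, ha, rfl⟩, _, ⟨b, hb, rfl⟩, rfl⟩
    exact ⟨a + b, Set.add_mem_add ha hb, charVec_add _ a b⟩
  · intro c hc
    refine mem_of_algebraMap_mem_extendScalars (K := AlgebraicClosure F) ?_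
    refine Submodule.span_le.2 ?_ (mem_span_charVec_of_dft_eq_zero hψ hn hc)
    rintro _ ⟨_, ⟨a, ha, b, hb, rfl⟩, rfl⟩
    simp only [charVec_add]
    exact mul_mem_extendScalars_schurProd
      (charVec_mem_extendScalars_cyclicCode hcop hβ hn hI₁ ha)
      (charVec_mem_extendScalars_cyclicCode hcop hβ hn hI₂ hb)

end CyclicCode

/-- For (nonempty) unions `I_1, I_2` of `q`-cyclotomic cosets modulo
`n` (`gcd(n,q)=1`), the product `C(I_1) * C(I_2)` is a cyclic code of length `n`,
dimension `|I_1 + I_2|` and minimum distance at least `n - Amp(I_1 + I_2) + 1`. -/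
theorem cyclicCode_schurProd_params
    {F : Type*} [Field F] [Fintype F] {n : ℕ} [NeZero n]
    (hn : Nat.Coprime n (Fintype.card F))
    (β : AlgebraicClosure F) (hβ : IsPrimitiveRoot β n)
    (I₁ I₂ : Set (ZMod n))
    (hI₁ : ∀ a ∈ I₁, (Fintype.card F : ZMod n) * a ∈ I₁)
    (hI₂ : ∀ a ∈ I₂, (Fintype.card F : ZMod n) * a ∈ I₂)
    (h₁ : I₁.Nonempty) (h₂ : I₂.Nonempty) :
    (∀ c ∈ schurProd (cyclicCode F n β I₁) (cyclicCode F n β I₂),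
        (fun k : Fin n => c (k + 1)) ∈ schurProd (cyclicCode F n β I₁) (cyclicCode F n β I₂)) ∧
    Module.finrank F (schurProd (cyclicCode F n β I₁) (cyclicCode F n β I₂)) =
      (I₁ + I₂).ncard ∧
    n - amp (I₁ + I₂) + 1 ≤
      minDist (schurProd (cyclicCode F n β I₁) (cyclicCode F n β I₂) : Set (Fin n → F)) := by
  have hn0 : (n : AlgebraicClosure F) ≠ 0 := natCast_ne_zero_of_coprime_card hn
  have hI : ∀ a ∈ I₁ + I₂, (Fintype.card F : ZMod n) * a ∈ I₁ + I₂ := by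
    rintro _ ⟨a, ha, b, hb, rfl⟩
    exact ⟨_, hI₁ a ha, _, hI₂ b hb, (mul_add _ a b).symm⟩
  have hψ := AddChar.zmodChar_primitive_of_primitive_root n hβ
  have hrank : Module.finrank F (cyclicCode F n β (I₁ + I₂)) = (I₁ + I₂).ncard := by
    rw [← finrank_extendScalars (K := AlgebraicClosure F),
      extendScalars_cyclicCode hn hβ hn0 hI, finrank_span_charVec hψ hn0]
  rw [schurProd_cyclicCode hn hβ hn0 hI₁ hI₂]
  refine ⟨fun c hc => comp_add_one_mem_cyclicCode hβ.pow_eq_one hc, hrank, ?_⟩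
  have hne : cyclicCode F n β (I₁ + I₂) ≠ ⊥ := by
    intro h
    rw [h, finrank_bot] at hrank
    exact ((Set.ncard_pos (Set.toFinite _)).2 (h₁.add h₂)).ne hrank
  obtain ⟨v, hv, hv0⟩ := Submodule.exists_mem_ne_zero_of_ne_bot hne
  refine le_csInf ⟨_, v, ⟨hv, hv0⟩, rfl⟩ ?_
  rintro _ ⟨x, ⟨hx, hx0⟩, rfl⟩
  obtain ⟨hle, c, hc⟩ := exists_subset_interval_amp (I₁ + I₂)
  have hbound := le_card_support_of_mem_span_charVec hψ hc
    (mem_span_charVec_of_dft_eq_zero hψ hn0 hx) fun h => hx0 <| funext fun k =>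
      (map_eq_zero (algebraMap F (AlgebraicClosure F))).1 (congrFun h k)
  rw [wt_algebraMap] at hbound
  omega
end
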